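/- arXiv:2202.12652 — 2 statements merged into one kernel-verified Lean document; each statement's English description precedes it below -/
import Mathlib

section
/- Let (X,d) be a zero-dimensional separable metric space such that X is mildly-Hurewicz measure zero with respect to every metric on X which generates the same topology as d does. Then X has the mildly Hurewicz property. -/
open Set Filter Topology TopologicalSpace

/-- A family of sets is a cover of `X` if its union is all of `X`. -/
def IsCover {X : Type*} (𝒰 : Set (Set X)) : Prop := ⋃₀ 𝒰 = Set.univ

/-- An open cover: every member is open and the family covers `X`. -/
def IsOpenCover {X : Type*} [TopologicalSpace X] (𝒰 : Set (Set X)) : Prop :=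
  (∀ U ∈ 𝒰, IsOpen U) ∧ IsCover 𝒰

/-- A clopen cover: every member is clopen and the family covers `X`. -/
def IsClopenCover {X : Type*} [TopologicalSpace X] (𝒰 : Set (Set X)) : Prop :=
  (∀ U ∈ 𝒰, IsClopen U) ∧ IsCover 𝒰

/-- A cover is groupable if it is a countable union of finite, pairwise disjoint
subfamilies `𝒢 n` such that each point belongs to `⋃ 𝒢 n` for all but finitely many `n`. -/
def IsGroupable {X : Type*} (𝒰 : Set (Set X)) : Prop :=
  ∃ 𝒢 : ℕ → Set (Set X),
    (∀ n, (𝒢 n).Finite) ∧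
    (∀ m n, m ≠ n → 𝒢 m ∩ 𝒢 n = ∅) ∧
    (⋃ n, 𝒢 n) = 𝒰 ∧
    (∀ x : X, ∀ᶠ n in Filter.atTop, x ∈ ⋃₀ 𝒢 n)

/-- The collection 𝒪 of all open covers of `X`. -/
def OpenCovers (X : Type*) [TopologicalSpace X] : Set (Set (Set X)) :=
  {𝒰 | IsOpenCover 𝒰}

/-- The collection 𝒞_𝒪 of all clopen covers of `X`. -/
def ClopenCovers (X : Type*) [TopologicalSpace X] : Set (Set (Set X)) :=
  {𝒰 | IsClopenCover 𝒰}

/-- The collection 𝒞_𝒪^gp of all groupable clopen covers of `X`. -/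
def GroupableClopenCovers (X : Type*) [TopologicalSpace X] : Set (Set (Set X)) :=
  {𝒰 | IsClopenCover 𝒰 ∧ IsGroupable 𝒰}

/-- `CDRsub 𝒜 ℬ`: for each sequence `A n` of members of `𝒜` there are pairwise
disjoint `B n ⊆ A n` with each `B n ∈ ℬ`. -/
def CDRsub {S : Type*} (𝒜 ℬ : Set (Set S)) : Prop :=
  ∀ A : ℕ → Set S, (∀ n, A n ∈ 𝒜) →
    ∃ B : ℕ → Set S, (∀ n, B n ⊆ A n) ∧
      (∀ m n, m ≠ n → B m ∩ B n = ∅) ∧ (∀ n, B n ∈ ℬ)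

/-- The selection principle `S_fin(𝒜, ℬ)`. -/
def Sfin {S : Type*} (𝒜 ℬ : Set (Set S)) : Prop :=
  ∀ U : ℕ → Set S, (∀ n, U n ∈ 𝒜) →
    ∃ V : ℕ → Set S, (∀ n, (V n).Finite ∧ V n ⊆ U n) ∧ (⋃ n, V n) ∈ ℬ

/-- The mildly Hurewicz property (selection from clopen covers). -/
def MildlyHurewicz (X : Type*) [TopologicalSpace X] : Prop :=
  ∀ 𝒰 : ℕ → Set (Set X), (∀ n, IsClopenCover (𝒰 n)) →
    ∃ 𝒱 : ℕ → Set (Set X),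
      (∀ n, (𝒱 n).Finite ∧ 𝒱 n ⊆ 𝒰 n) ∧
      ∀ x : X, ∀ᶠ n in Filter.atTop, x ∈ ⋃₀ 𝒱 n

/-- The Hurewicz property (selection from open covers). -/
def HurewiczProperty (X : Type*) [TopologicalSpace X] : Prop :=
  ∀ 𝒰 : ℕ → Set (Set X), (∀ n, IsOpenCover (𝒰 n)) →
    ∃ 𝒱 : ℕ → Set (Set X),
      (∀ n, (𝒱 n).Finite ∧ 𝒱 n ⊆ 𝒰 n) ∧
      ∀ x : X, ∀ᶠ n in Filter.atTop, x ∈ ⋃₀ 𝒱 n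

/-- The star `St(A, 𝒞) = ⋃ {P ∈ 𝒞 : A ∩ P ≠ ∅}`. -/
def St {X : Type*} (A : Set X) (𝒞 : Set (Set X)) : Set X :=
  ⋃₀ {P ∈ 𝒞 | (A ∩ P).Nonempty}

/-- The star-Hurewicz property. -/
def StarHurewicz (X : Type*) [TopologicalSpace X] : Prop :=
  ∀ 𝒰 : ℕ → Set (Set X), (∀ n, IsOpenCover (𝒰 n)) →
    ∃ 𝒱 : ℕ → Set (Set X),
      (∀ n, (𝒱 n).Finite ∧ 𝒱 n ⊆ 𝒰 n) ∧
      ∀ x : X, ∀ᶠ n in Filter.atTop, x ∈ St (⋃₀ (𝒱 n)) (𝒰 n)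

/-- A space is crowded if it has no isolated points. -/
def Crowded (X : Type*) [TopologicalSpace X] : Prop :=
  ∀ x : X, ¬ IsOpen ({x} : Set X)

/-- A space is zero-dimensional if it has a basis consisting of clopen sets. -/
def ZeroDimensional (X : Type*) [TopologicalSpace X] : Prop :=
  ∃ 𝓑 : Set (Set X), TopologicalSpace.IsTopologicalBasis 𝓑 ∧ ∀ B ∈ 𝓑, IsClopen B

/-- Two metrics on `X` generate the same topology. -/
def SameTopology {X : Type*} (m₁ m₂ : MetricSpace X) : Prop :=
  m₁.toUniformSpace.toTopologicalSpace = m₂.toUniformSpace.toTopologicalSpace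

/-- The mildly-Hurewicz basis property of a metric space. -/
def MildlyHurewiczBasis (X : Type*) [MetricSpace X] : Prop :=
  ∀ 𝓑 : Set (Set X), TopologicalSpace.IsTopologicalBasis 𝓑 → (∀ B ∈ 𝓑, IsClopen B) →
    ∃ U : ℕ → Set X, (∀ n, U n ∈ 𝓑) ∧
      IsClopenCover (Set.range U) ∧ IsGroupable (Set.range U) ∧
      Filter.Tendsto (fun n => Metric.diam (U n)) Filter.atTop (nhds 0)

/-- The Hurewicz basis property of a metric space. -/
def HurewiczBasis (X : Type*) [MetricSpace X] : Prop :=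
  ∀ 𝓑 : Set (Set X), TopologicalSpace.IsTopologicalBasis 𝓑 →
    ∃ U : ℕ → Set X, (∀ n, U n ∈ 𝓑) ∧
      IsCover (Set.range U) ∧ IsGroupable (Set.range U) ∧
      Filter.Tendsto (fun n => Metric.diam (U n)) Filter.atTop (nhds 0)

/-- `X` is mildly-Hurewicz measure zero with respect to the metric `m`. -/
def MildlyHurewiczMeasureZero (X : Type*) (m : MetricSpace X) : Prop :=
  letI := m
  ∀ ε : ℕ → ℝ, (∀ n, 0 < ε n) →
    ∃ 𝒱 : ℕ → Set (Set X),
      (∀ n, (𝒱 n).Finite) ∧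
      (∀ n, ∀ V ∈ 𝒱 n, IsClopen V ∧ Metric.diam V < ε n) ∧
      IsClopenCover (⋃ n, 𝒱 n) ∧ IsGroupable (⋃ n, 𝒱 n)

/-- `X` is Hurewicz measure zero with respect to the metric `m`. -/
def HurewiczMeasureZero (X : Type*) (m : MetricSpace X) : Prop :=
  letI := m
  ∀ ε : ℕ → ℝ, (∀ n, 0 < ε n) →
    ∃ 𝒱 : ℕ → Set (Set X),
      (∀ n, (𝒱 n).Finite) ∧
      (∀ n, ∀ V ∈ 𝒱 n, IsOpen V ∧ Metric.diam V < ε n) ∧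
      IsCover (⋃ n, 𝒱 n) ∧ IsGroupable (⋃ n, 𝒱 n)

/-- `X` is star-Hurewicz measure zero with respect to the metric `m`. -/
def StarHurewiczMeasureZero (X : Type*) (m : MetricSpace X) : Prop :=
  letI := m
  ∀ ε : ℕ → ℝ, (∀ n, 0 < ε n) →
    ∃ 𝒱 : ℕ → Set (Set X),
      (∀ n, (𝒱 n).Finite) ∧
      (∀ n, ∀ V ∈ 𝒱 n, IsOpen V ∧ Metric.diam V < ε n) ∧
      IsCover (Set.range fun n =>
        St (⋃₀ (𝒱 n)) {U : Set X | IsOpen U ∧ Metric.diam U < ε n}) ∧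
      IsGroupable (Set.range fun n =>
        St (⋃₀ (𝒱 n)) {U : Set X | IsOpen U ∧ Metric.diam U < ε n})

/-- `𝓑 ∧ 𝒰 = {B ∩ U : B ∈ 𝓑, U ∈ 𝒰}`. -/
def Wedge {X : Type*} (𝓑 𝒰 : Set (Set X)) : Set (Set X) :=
  {S | ∃ B ∈ 𝓑, ∃ U ∈ 𝒰, S = B ∩ U}


/-- In a second countable space, a choice of clopen neighbourhoods `c x` is refined by the
fibres of a continuous map into `ℕ`. -/
theorem exists_continuous_nat_fiber_subset {X : Type*} [TopologicalSpace X]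
    [SecondCountableTopology X] [Nonempty X] (c : X → Set X)
    (hc : ∀ x, IsClopen (c x)) (hx : ∀ x, x ∈ c x) :
    ∃ f : X → ℕ, Continuous f ∧ ∀ x, ∃ z, ∀ y, f y = f x → y ∈ c z := by
  classical
  obtain ⟨s, hs, hcov⟩ := TopologicalSpace.countable_cover_nhds fun x => (hc x).isOpen.mem_nhds (hx x)
  have hne : s.Nonempty := by
    by_contra hempty
    rw [not_nonempty_iff_eq_empty] at hempty
    simp [hempty, eq_comm (a := (∅ : Set X))] at hcov
  obtain ⟨e, rfl⟩ := hs.exists_eq_range hne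
  have hex : ∀ x, ∃ n, x ∈ c (e n) := fun x => by
    have := hcov.ge (mem_univ x)
    simpa using this
  refine ⟨fun x => Nat.find (hex x), ?_, fun x => ⟨e (Nat.find (hex x)), fun y hy => ?_⟩⟩
  · rw [continuous_discrete_rng]
    intro n
    have heq : (fun x => Nat.find (hex x)) ⁻¹' {n} = c (e n) ∩ ⋂ k ∈ Iio n, (c (e k))ᶜ := by
      ext x
      simp [Nat.find_eq_iff]
    rw [heq]
    exact (hc _).isOpen.inter
      ((finite_Iio n).isOpen_biInter fun k _ => (hc (e k)).compl.isOpen)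
  · have := Nat.find_spec (hex y)
    exact (congrArg (fun n => y ∈ c (e n)) hy).mp this

/-- A sequence of clopen covers of a zero-dimensional separable metric space is subordinate to
an embedding into the Baire space: points sharing the `n`-th coordinate lie in a common member
of the `n`-th cover. -/
theorem exists_isEmbedding_baire_subordinate {X : Type*} [MetricSpace X]
    [SecondCountableTopology X] [Nonempty X] (hz : ZeroDimensional X)
    (𝒰 : ℕ → Set (Set X)) (h𝒰 : ∀ n, IsClopenCover (𝒰 n)) :
    ∃ g : X → ℕ → ℕ, IsEmbedding g ∧
      ∀ n x, ∃ U ∈ 𝒰 n, ∀ y, g y n = g x n → y ∈ U := by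
  obtain ⟨𝓑, h𝓑, hclopen⟩ := hz
  have hcell : ∀ (n : ℕ) (x : X), ∃ C : Set X, IsClopen C ∧ x ∈ C ∧ (∃ U ∈ 𝒰 n, C ⊆ U) ∧
      C ⊆ Metric.ball x (1 / (n + 1)) := by
    intro n x
    obtain ⟨U, hU, hxU⟩ : x ∈ ⋃₀ 𝒰 n := (h𝒰 n).2.ge (mem_univ x)
    obtain ⟨B, hB, hxB, hBsub⟩ := h𝓑.mem_nhds_iff.1
      (Metric.ball_mem_nhds x (Nat.one_div_pos_of_nat (α := ℝ) (n := n)))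
    exact ⟨U ∩ B, ((h𝒰 n).1 U hU).inter (hclopen B hB), ⟨hxU, hxB⟩,
      ⟨U, hU, inter_subset_left⟩, inter_subset_right.trans hBsub⟩
  choose c hc hxc hcU hcball using hcell
  choose f hf hfc using fun n => exists_continuous_nat_fiber_subset (c n) (hc n) (hxc n)
  have hcont : Continuous fun x n => f n x := continuous_pi hf
  have hind : IsInducing fun x n => f n x := by
    rw [isInducing_iff_nhds]
    refine fun x => le_antisymm (hcont.tendsto x).le_comap ?_
    rw [Metric.nhds_basis_ball.ge_iff]
    intro ε hε
    obtain ⟨n, hn⟩ := exists_nat_one_div_lt (half_pos hε)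
    have hopen : IsOpen {a : ℕ → ℕ | a n = f n x} :=
      (isOpen_discrete ({f n x} : Set ℕ)).preimage (continuous_apply (A := fun _ => ℕ) n)
    refine mem_comap.2 ⟨_, hopen.mem_nhds rfl, fun y hy => ?_⟩
    obtain ⟨z, hz⟩ := hfc n x
    have hyz := hcball n z (hz y hy)
    have hxz := hcball n z (hz x rfl)
    rw [Metric.mem_ball] at hyz hxz ⊢
    linarith [dist_triangle_right y x z]
  refine ⟨fun x n => f n x, hind.isEmbedding, fun n x => ?_⟩
  obtain ⟨z, hz⟩ := hfc n x
  obtain ⟨U, hU, hsub⟩ := hcU n z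
  exact ⟨U, hU, fun y hy => hsub (hz y hy)⟩

/-- An embedding into the Baire space induces a compatible metric bounded by `1`, in which points
closer than `(1 / 2) ^ n` share the `n`-th coordinate. -/
theorem exists_metricSpace_of_isEmbedding_baire {X : Type*} [m : MetricSpace X] {g : X → ℕ → ℕ}
    (hg : IsEmbedding g) :
    ∃ ρ : MetricSpace X, SameTopology ρ m ∧ (∀ x y, ρ.dist x y ≤ 1) ∧
      ∀ n x y, ρ.dist x y < (1 / 2) ^ n → g x n = g y n := by
  let := PiNat.metricSpaceNatNat
  exact ⟨MetricSpace.induced g hg.injective inferInstance, hg.eq_induced.symm,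
    fun x y => PiNat.dist_le_one (g x) (g y),
    fun n x y hxy => PiNat.apply_eq_of_dist_lt hxy le_rfl⟩

theorem dist_lt_of_diam_lt_of_dist_le {X : Type*} [PseudoMetricSpace X] {C δ : ℝ}
    (hC : ∀ x y : X, dist x y ≤ C) {V : Set X} (hV : Metric.diam V < δ) {x y : X}
    (hx : x ∈ V) (hy : y ∈ V) : dist x y < δ :=
  (Metric.dist_le_diam_of_mem (Metric.isBounded_iff.2 ⟨C, fun _ _ _ _ => hC _ _⟩) hx hy).trans_lt
    hV

/-- A finite set meets only finitely many members of a pairwise disjoint sequence of sets. -/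
theorem eventually_disjoint_of_finite {S : Type*} {𝒢 : ℕ → Set S}
    (h𝒢 : ∀ m n, m ≠ n → 𝒢 m ∩ 𝒢 n = ∅) {F : Set S} (hF : F.Finite) :
    ∀ᶠ k in atTop, ∀ V ∈ 𝒢 k, V ∉ F := by
  have hpoint : ∀ V ∈ F, ∀ᶠ k in atTop, V ∉ 𝒢 k := by
    intro V _
    by_cases hV : ∃ j, V ∈ 𝒢 j
    · obtain ⟨j, hj⟩ := hV
      filter_upwards [eventually_gt_atTop j] with k hk hVk
      have : V ∈ 𝒢 j ∩ 𝒢 k := ⟨hj, hVk⟩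
      rw [h𝒢 j k hk.ne] at this
      exact this
    · exact Eventually.of_forall fun k hk => hV ⟨k, hk⟩
  filter_upwards [(eventually_all_finite hF).2 hpoint] with k hk V hV hVF
  exact hk V hVF hV

theorem stmt6 {X : Type*} [m : MetricSpace X]
    (hz : ZeroDimensional X) (hsep : TopologicalSpace.SeparableSpace X)
    (h : ∀ ρ : MetricSpace X, SameTopology ρ m → MildlyHurewiczMeasureZero X ρ) :
    MildlyHurewicz X := by
  intro 𝒰 h𝒰
  rcases isEmpty_or_nonempty X with hX | hX
  · exact ⟨fun _ => ∅, fun n => ⟨finite_empty, empty_subset _⟩, fun x => hX.elim x⟩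
  have : SecondCountableTopology X := UniformSpace.secondCountable_of_separable X
  obtain ⟨g, hg, hgU⟩ := exists_isEmbedding_baire_subordinate hz 𝒰 h𝒰
  obtain ⟨ρ, hρ, hbdd, hρg⟩ := exists_metricSpace_of_isEmbedding_baire hg
  obtain ⟨𝒱, hfin, hdiam, -, 𝒢, h𝒢fin, h𝒢disj, h𝒢union, h𝒢⟩ :=
    h ρ hρ (fun n => (1 / 2) ^ n) fun n => by positivity
  have hsmall : ∀ n, ∀ V ∈ ⋃ i, 𝒱 i, V ∉ ⋃ i ∈ Iio n, 𝒱 i → ∃ U ∈ 𝒰 n, V ⊆ U := by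
    intro n V hV hVn
    obtain ⟨i, hi⟩ := mem_iUnion.1 hV
    have hni : n ≤ i := by
      by_contra! hlt
      exact hVn (mem_biUnion hlt hi)
    rcases V.eq_empty_or_nonempty with rfl | ⟨x, hx⟩
    · obtain ⟨U, hU, -⟩ := hgU n hX.some
      exact ⟨U, hU, empty_subset U⟩
    · obtain ⟨U, hU, hsub⟩ := hgU n x
      refine ⟨U, hU, fun y hy => hsub y (hρg n y x ?_)⟩
      exact (@dist_lt_of_diam_lt_of_dist_le X ρ.toPseudoMetricSpace 1 _ hbdd V
        (hdiam i V hi).2 y x hy hx).trans_le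
        (pow_le_pow_of_le_one (by norm_num) (by norm_num) hni)
  have hgroup : ∀ n, ∃ k, n ≤ k ∧ ∀ V ∈ 𝒢 k, ∃ U ∈ 𝒰 n, V ⊆ U := by
    intro n
    have hF : (⋃ i ∈ Iio n, 𝒱 i).Finite := (finite_Iio n).biUnion fun i _ => hfin i
    obtain ⟨k, hk, hnk⟩ :=
      ((eventually_disjoint_of_finite h𝒢disj hF).and (eventually_ge_atTop n)).exists
    exact ⟨k, hnk, fun V hV =>
      hsmall n V (h𝒢union ▸ mem_iUnion.2 ⟨k, hV⟩) (hk V hV)⟩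
  choose k hnk hk using hgroup
  choose! u hu hVu using hk
  refine ⟨fun n => u n '' 𝒢 (k n), fun n => ⟨(h𝒢fin _).image _, ?_⟩, fun x => ?_⟩
  · rintro _ ⟨V, hV, rfl⟩
    exact hu n V hV
  · filter_upwards [(tendsto_atTop_mono hnk tendsto_id).eventually (h𝒢 x)] with n hn
    obtain ⟨V, hV, hxV⟩ := hn
    exact ⟨u n V, mem_image_of_mem _ hV, hVu n V hV hxV⟩
end

section
/- Let (X,d) be a zero-dimensional separable crowded metric space. Then X has the Hurewicz property if and only if X is Hurewicz measure zero with respect to every metric on X which generates the same topology as d does. -/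
open Set Filter Topology TopologicalSpace

theorem Crowded.infinite_of_isOpen {X : Type*} [TopologicalSpace X] [T1Space X]
    (hcr : Crowded X) {U : Set X} (hU : IsOpen U) (hne : U.Nonempty) : U.Infinite := by
  obtain ⟨x, hx⟩ := hne
  have : NeBot (𝓝[≠] x) := by
    rw [neBot_iff]
    intro h
    exact hcr x ((isOpen_singleton_iff_punctured_nhds x).mpr h)
  exact infinite_of_mem_nhds x (hU.mem_nhds hx)

/-- In a crowded space an open set is a union of finitely many open subsets avoiding a given
finite family. -/
theorem Crowded.exists_finite_sUnion_eq_of_isOpen {X : Type*} [TopologicalSpace X] [T1Space X]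
    (hcr : Crowded X) {U : Set X} (hU : IsOpen U) {F : Set (Set X)} (hF : F.Finite) :
    ∃ W : Set (Set X), W.Finite ∧ (∀ w ∈ W, IsOpen w ∧ w ⊆ U) ∧ Disjoint F W ∧ ⋃₀ W = U := by
  rcases U.eq_empty_or_nonempty with rfl | hne
  · exact ⟨∅, finite_empty, by simp, by simp, by simp⟩
  have hinj : InjOn (fun a => U \ {a}) U := by
    intro a ha b hb h
    by_contra hab
    have : a ∈ U \ {b} := ⟨ha, hab⟩
    rw [← show U \ {a} = U \ {b} from h] at this
    exact this.2 rfl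
  have hfin : (U ∩ (fun a => U \ {a}) ⁻¹' F).Finite :=
    Finite.of_finite_image (hF.subset (by rintro _ ⟨a, ha, rfl⟩; exact ha.2))
      (hinj.mono inter_subset_left)
  have hinf : (U \ (U ∩ (fun a => U \ {a}) ⁻¹' F)).Infinite :=
    (hcr.infinite_of_isOpen hU hne).sdiff hfin
  obtain ⟨a, ⟨ha, haF⟩, b, ⟨hb, hbF⟩, hab⟩ := hinf.nontrivial
  refine ⟨{U \ {a}, U \ {b}}, by simp, ?_, ?_, ?_⟩
  · rintro w (rfl | rfl)
    · exact ⟨hU.sdiff isClosed_singleton, sdiff_subset⟩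
    · exact ⟨hU.sdiff isClosed_singleton, sdiff_subset⟩
  · rw [Set.disjoint_right]
    rintro w (rfl | rfl) hw
    · exact haF ⟨ha, hw⟩
    · exact hbF ⟨hb, hw⟩
  · ext x
    simp only [sUnion_insert, sUnion_singleton, mem_union, Set.mem_sdiff, mem_singleton_iff]
    grind

/-- In a crowded space a sequence of finite families of open sets can be refined to a sequence
of pairwise disjoint finite families of open sets with the same unions. -/
theorem Crowded.exists_pairwise_disjoint_refinement {X : Type*} [TopologicalSpace X] [T1Space X]
    (hcr : Crowded X) {V : ℕ → Set (Set X)} (hfin : ∀ n, (V n).Finite)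
    (hopen : ∀ n, ∀ U ∈ V n, IsOpen U) :
    ∃ W : ℕ → Set (Set X), (∀ n, (W n).Finite) ∧
      (∀ n, ∀ w ∈ W n, IsOpen w ∧ ∃ U ∈ V n, w ⊆ U) ∧
      Pairwise (Function.onFun Disjoint W) ∧ ∀ n, ⋃₀ W n = ⋃₀ V n := by
  have step : ∀ n (F : Set (Set X)), F.Finite → ∃ W : Set (Set X), W.Finite ∧
      (∀ w ∈ W, IsOpen w ∧ ∃ U ∈ V n, w ⊆ U) ∧ Disjoint F W ∧ ⋃₀ W = ⋃₀ V n := by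
    intro n F hF
    choose! f hf hsub hdis hun using fun U (hU : U ∈ V n) =>
      hcr.exists_finite_sUnion_eq_of_isOpen (hopen n U hU) hF
    refine ⟨⋃ U ∈ V n, f U, (hfin n).biUnion hf, ?_, ?_, ?_⟩
    · intro w hw
      obtain ⟨U, hU, hw⟩ := mem_iUnion₂.mp hw
      exact ⟨(hsub U hU w hw).1, U, hU, (hsub U hU w hw).2⟩
    · simpa only [disjoint_iUnion_right] using hdis
    · rw [sUnion_eq_biUnion (s := V n)]
      simp only [sUnion_iUnion]
      exact iUnion₂_congr hun
  choose! f hf hsub hdis hun using step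
  let A : ℕ → Set (Set X) := fun n => Nat.rec ∅ (fun k B => B ∪ f k B) n
  have hA : ∀ n, (A n).Finite := by
    intro n
    induction n with
    | zero => exact finite_empty
    | succ k ih => exact ih.union (hf k _ ih)
  have hmono : Monotone A := monotone_nat_of_le_succ fun n => subset_union_left
  refine ⟨fun n => f n (A n), fun n => hf n _ (hA n), fun n => hsub n _ (hA n), ?_,
    fun n => hun n _ (hA n)⟩
  rw [pairwise_disjoint_on]
  intro i j hij
  exact (hdis j _ (hA j)).mono_left
    ((subset_union_right (s := A i)).trans (hmono (Nat.succ_le_of_lt hij)))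

theorem HurewiczProperty.hurewiczMeasureZero {X : Type*} [m : MetricSpace X]
    (h : HurewiczProperty X) (hcr : Crowded X) : HurewiczMeasureZero X m := by
  intro ε hε
  obtain ⟨V, hV, hcov⟩ := h (fun n => range fun x => Metric.ball x (ε n / 3)) fun n =>
    ⟨by rintro _ ⟨x, rfl⟩; exact Metric.isOpen_ball, by
      refine eq_univ_of_forall fun x => ⟨_, ⟨x, rfl⟩, Metric.mem_ball_self ?_⟩
      linarith [hε n]⟩
  obtain ⟨W, hWfin, hW, hdis, hun⟩ := hcr.exists_pairwise_disjoint_refinement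
    (fun n => (hV n).1) (fun n U hU => by
      obtain ⟨x, rfl⟩ := (hV n).2 hU
      exact Metric.isOpen_ball)
  have hcovW : ∀ x, ∀ᶠ n in atTop, x ∈ ⋃₀ W n := by simpa only [hun] using hcov
  refine ⟨W, hWfin, fun n w hw => ⟨(hW n w hw).1, ?_⟩, ?_, W, hWfin,
    fun i j hij => (hdis hij).inter_eq, rfl, hcovW⟩
  · obtain ⟨U, hU, hwU⟩ := (hW n w hw).2
    obtain ⟨x, rfl⟩ := (hV n).2 hU
    have h₁ := Metric.diam_mono hwU Metric.isBounded_ball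
    have h₂ := Metric.diam_ball (x := x) (r := ε n / 3) (by linarith [hε n])
    linarith [hε n]
  · refine eq_univ_of_forall fun x => ?_
    obtain ⟨n, w, hw, hx⟩ := (hcovW x).exists
    exact ⟨w, mem_iUnion.mpr ⟨n, hw⟩, hx⟩

/-- A groupable union of finite families yields, by passing to a subsequence of its groups,
finite families whose members come from arbitrarily late stages. -/
theorem IsGroupable.exists_finite_late {X : Type*} {V : ℕ → Set (Set X)}
    (hfin : ∀ n, (V n).Finite) (hgp : IsGroupable (⋃ n, V n)) :
    ∃ H : ℕ → Set (Set X), (∀ n, (H n).Finite) ∧ (∀ n, ∀ U ∈ H n, ∃ k ≥ n, U ∈ V k) ∧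
      ∀ x, ∀ᶠ n in atTop, x ∈ ⋃₀ H n := by
  obtain ⟨G, hGfin, hdis, hun, hcov⟩ := hgp
  have late : ∀ n, ∃ j ≥ n, ∀ U ∈ G j, ∃ k ≥ n, U ∈ V k := by
    intro n
    have hF : (⋃ k ∈ Iio n, V k).Finite := (finite_Iio n).biUnion fun k _ => hfin k
    have hbad : {j | (G j ∩ ⋃ k ∈ Iio n, V k).Nonempty}.Finite := by
      choose! u hu using fun j (hj : j ∈ {j | (G j ∩ ⋃ k ∈ Iio n, V k).Nonempty}) => hj
      refine Finite.of_finite_image (f := u) (hF.subset ?_) ?_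
      · rintro _ ⟨j, hj, rfl⟩
        exact (hu j hj).2
      · intro i hi j hj hij
        by_contra hne
        have : u i ∈ G i ∩ G j := ⟨(hu i hi).1, hij ▸ (hu j hj).1⟩
        simp [hdis i j hne] at this
    obtain ⟨j, hj, hnj⟩ := (hbad.infinite_compl).exists_gt n
    refine ⟨j, hnj.le, fun U hU => ?_⟩
    have hUV : U ∈ ⋃ k, V k := hun ▸ mem_iUnion.mpr ⟨j, hU⟩
    obtain ⟨k, hk⟩ := mem_iUnion.mp hUV
    refine ⟨k, not_lt.mp fun hkn => hj ⟨U, hU, mem_biUnion (mem_Iio.mpr hkn) hk⟩, hk⟩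
  choose j hj hlate using late
  exact ⟨fun n => G (j n), fun n => hGfin _, hlate,
    fun x => (tendsto_atTop_mono hj tendsto_id).eventually (hcov x)⟩

/-- An open cover by members of a clopen sequence generating the topology is refined by the
fibres of a continuous function to `ℕ`. -/
theorem IsOpenCover.exists_continuous_nat {X : Type*} [TopologicalSpace X] {B : ℕ → Set X}
    (hB : IsTopologicalBasis (range B)) (hclopen : ∀ n, IsClopen (B n)) {𝒰 : Set (Set X)}
    (h𝒰 : IsOpenCover 𝒰) :
    ∃ f : X → ℕ, Continuous f ∧ ∀ x, ∃ U ∈ 𝒰, ∀ y, f y = f x → y ∈ U := by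
  classical
  have hex : ∀ x, ∃ i, x ∈ B i ∧ ∃ U ∈ 𝒰, B i ⊆ U := by
    intro x
    obtain ⟨U, hU, hx⟩ := h𝒰.2.ge (mem_univ x)
    obtain ⟨_, ⟨i, rfl⟩, hxi, hi⟩ := hB.exists_subset_of_mem_open hx (h𝒰.1 U hU)
    exact ⟨i, hxi, U, hU, hi⟩
  refine ⟨fun x => Nat.find (hex x), ?_, fun x => ?_⟩
  · refine IsLocallyConstant.continuous (IsLocallyConstant.iff_exists_open _ |>.mpr fun x => ?_)
    obtain ⟨hx, hi⟩ := Nat.find_spec (hex x)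
    refine ⟨B (Nat.find (hex x)) ∩ ⋂ k ∈ {k | k < Nat.find (hex x) ∧ x ∉ B k}, (B k)ᶜ, ?_, ?_, ?_⟩
    · exact (hclopen _).isOpen.inter (((finite_Iio (Nat.find (hex x))).subset
        fun k hk => hk.1).isOpen_biInter fun k _ => (hclopen k).compl.isOpen)
    · exact ⟨hx, mem_iInter₂.mpr fun k hk => hk.2⟩
    · rintro y ⟨hy, hy'⟩
      rw [Nat.find_eq_iff]
      refine ⟨⟨hy, hi⟩, fun k hk hyk => ?_⟩
      have hxk : x ∈ B k := by
        by_contra hxk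
        exact mem_iInter₂.mp hy' k ⟨hk, hxk⟩ hyk.1
      exact Nat.find_min (hex x) hk ⟨hxk, hyk.2⟩
  · obtain ⟨-, U, hU, hsub⟩ := Nat.find_spec (hex x)
    refine ⟨U, hU, fun y hy => hsub ?_⟩
    rw [← show Nat.find (hex y) = Nat.find (hex x) from hy]
    exact (Nat.find_spec (hex y)).1

theorem ZeroDimensional.exists_seq_clopen_basis {X : Type*} [TopologicalSpace X]
    [SecondCountableTopology X] (hz : ZeroDimensional X) :
    ∃ B : ℕ → Set X, IsTopologicalBasis (range B) ∧ ∀ n, IsClopen (B n) := by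
  obtain ⟨𝓑, h𝓑, hclopen⟩ := hz
  obtain ⟨𝓒, hsub, hcount, h𝓒⟩ := h𝓑.exists_countable
  obtain ⟨B, hB⟩ := (hcount.insert ∅).exists_eq_range (insert_nonempty _ _)
  refine ⟨B, hB ▸ h𝓒.insert_empty, fun n => ?_⟩
  rcases hB.ge (mem_range_self n) with h | h
  · exact h ▸ isClopen_empty
  · exact hclopen _ (hsub h)

/-- Given open covers `𝒰 n` of a zero-dimensional second countable space, there is a compatible
metric for which all sufficiently small nonempty sets are contained in a member of `𝒰 n`. -/
theorem ZeroDimensional.exists_metricSpace_diam_lt {X : Type*} [t : TopologicalSpace X] [T0Space X]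
    [SecondCountableTopology X] (hz : ZeroDimensional X) {𝒰 : ℕ → Set (Set X)}
    (h𝒰 : ∀ n, IsOpenCover (𝒰 n)) :
    ∃ ρ : MetricSpace X, ρ.toUniformSpace.toTopologicalSpace = t ∧
      ∀ n, ∀ V : Set X, V.Nonempty → @Metric.diam X ρ.toPseudoMetricSpace V < (1 / 2) ^ n →
        ∃ U ∈ 𝒰 n, V ⊆ U := by
  classical
  obtain ⟨B, hB, hclopen⟩ := hz.exists_seq_clopen_basis
  choose f hf hfU using fun n => (h𝒰 n).exists_continuous_nat hB hclopen
  let g : X → ℕ → ℕ × Bool := fun x n => (f n x, decide (x ∈ B n))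
  have hg : Continuous g := by
    refine continuous_pi fun n => (hf n).prodMk ?_
    exact (IsLocallyConstant.iff_exists_open _ |>.mpr fun x => by
      by_cases hx : x ∈ B n
      · exact ⟨B n, (hclopen n).isOpen, hx, fun y hy => by simp [hx, hy]⟩
      · exact ⟨(B n)ᶜ, (hclopen n).compl.isOpen, hx, fun y hy => by
          simp [hx, show y ∉ B n from hy]⟩).continuous
  have hind : IsInducing g := by
    refine ⟨le_antisymm hg.le_induced ?_⟩
    rw [hB.eq_generateFrom]
    refine le_generateFrom ?_
    rintro _ ⟨n, rfl⟩
    refine ⟨{z | (z n).2 = true}, ?_, ?_⟩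
    · exact (isOpen_discrete {true}).preimage (continuous_snd.comp (continuous_apply n))
    · ext x
      simp [g]
  let ρ₀ : MetricSpace (ℕ → ℕ × Bool) := PiNat.metricSpace
  let ρ : MetricSpace X := MetricSpace.induced g hind.injective ρ₀
  refine ⟨ρ, hind.eq_induced.symm, fun n V hV hdiam => ?_⟩
  obtain ⟨x, hx⟩ := hV
  obtain ⟨U, hU, hsub⟩ := hfU n x
  refine ⟨U, hU, fun y hy => hsub y ?_⟩
  have hbdd : @Bornology.IsBounded X ρ.toBornology V :=
    (@Metric.isBounded_iff X ρ.toPseudoMetricSpace V).mpr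
      ⟨1, fun a _ b _ => PiNat.dist_le_one (g a) (g b)⟩
  have hlt := (@Metric.dist_le_diam_of_mem X V y x ρ.toPseudoMetricSpace hbdd hy hx).trans_lt hdiam
  exact congrArg Prod.fst (PiNat.apply_eq_of_dist_lt (x := g y) (y := g x) hlt le_rfl)

theorem stmt14 {X : Type*} [m : MetricSpace X]
    (hz : ZeroDimensional X) (hsep : TopologicalSpace.SeparableSpace X) (hcr : Crowded X) :
    HurewiczProperty X ↔
      ∀ ρ : MetricSpace X, SameTopology ρ m → HurewiczMeasureZero X ρ := by
  constructor
  · intro h ρ hρ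
    unfold SameTopology at hρ
    rw [← hρ] at h hcr
    exact HurewiczProperty.hurewiczMeasureZero (m := ρ) h hcr
  · intro h 𝒰 h𝒰
    have : SecondCountableTopology X := UniformSpace.secondCountable_of_separable X
    obtain ⟨ρ, hρ, hsmall⟩ := hz.exists_metricSpace_diam_lt h𝒰
    obtain ⟨V, hfin, hV, -, hgp⟩ := h ρ hρ (fun n => (1 / 2) ^ n) fun n => by positivity
    obtain ⟨H, hHfin, hlate, hcov⟩ := hgp.exists_finite_late hfin
    have hsub : ∀ n, ∀ S ∈ {S ∈ H n | S.Nonempty}, ∃ U ∈ 𝒰 n, S ⊆ U := by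
      rintro n S ⟨hS, hne⟩
      obtain ⟨k, hk, hSk⟩ := hlate n S hS
      exact hsmall n S hne ((hV k S hSk).2.trans_le
        (pow_le_pow_of_le_one (by norm_num) (by norm_num) hk))
    choose! u hu hSu using hsub
    refine ⟨fun n => u n '' {S ∈ H n | S.Nonempty}, fun n =>
      ⟨((hHfin n).subset (sep_subset _ _)).image _, ?_⟩, fun x => ?_⟩
    · rintro _ ⟨S, hS, rfl⟩
      exact hu n S hS
    · filter_upwards [hcov x] with n hn
      obtain ⟨S, hS, hx⟩ := hn
      exact ⟨_, mem_image_of_mem _ ⟨hS, x, hx⟩, hSu n S ⟨hS, x, hx⟩ hx⟩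
end
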